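/- arXiv:math/0506207 — 9 statements merged into one kernel-verified Lean document; each statement's English description precedes it below -/
import Mathlib

section
/- For every complex number z with Re z > 1, the alternating Kurepa function satisfies the functional equation A(z) + A(z−1) = Γ(z+1). -/
open MeasureTheory

/-- The alternating Kurepa function, defined for `Re z > 0` by
`A(z) = ∫₀^∞ e^{−t} (t^{z+1} − e^{iπz} t)/(t+1) dt`, where `(−1)^z` is taken as the
principal value `e^{iπz}`. -/
noncomputable def altKurepa (z : ℂ) : ℂ :=
  ∫ t in Set.Ioi (0 : ℝ),
    (Real.exp (-t) : ℂ) * ((t : ℂ) ^ (z + 1) -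
      Complex.exp ((Real.pi : ℂ) * Complex.I * z) * (t : ℂ)) / ((t : ℂ) + 1)

/-- The integrand defining `altKurepa z` is integrable on `(0, ∞)`, even for `-2 < z.re`. -/
theorem integrableOn_altKurepa_integrand {z : ℂ} (hz : -2 < z.re) :
    IntegrableOn (fun t : ℝ => (Real.exp (-t) : ℂ) * ((t : ℂ) ^ (z + 1) -
      Complex.exp ((Real.pi : ℂ) * Complex.I * z) * (t : ℂ)) / ((t : ℂ) + 1)) (Set.Ioi 0) := by
  have hpow := Complex.GammaIntegral_convergent (s := z + 2) (by simp; linarith)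
  have hlin := (Complex.GammaIntegral_convergent (s := 2) (by simp)).const_mul
    (Complex.exp ((Real.pi : ℂ) * Complex.I * z))
  have hmeas : AEStronglyMeasurable (fun t : ℝ => ((t : ℂ) + 1)⁻¹)
      (volume.restrict (Set.Ioi 0)) :=
    Measurable.aestronglyMeasurable (by fun_prop)
  have hbound : ∀ᵐ t : ℝ ∂volume.restrict (Set.Ioi 0), ‖((t : ℂ) + 1)⁻¹‖ ≤ 1 := by
    filter_upwards [ae_restrict_mem measurableSet_Ioi] with t ht
    have ht : 0 < t := ht
    rw [← Complex.ofReal_one, ← Complex.ofReal_add, norm_inv,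
      Complex.norm_of_nonneg (by linarith)]
    exact inv_le_one_of_one_le₀ (by linarith)
  refine ((hpow.sub hlin).bdd_mul hmeas hbound).congr (Filter.Eventually.of_forall fun t => ?_)
  have hz1 : z + 2 - 1 = z + 1 := by ring
  have h1 : (2 : ℂ) - 1 = 1 := by norm_num
  simp only [Pi.sub_apply, hz1, h1, Complex.cpow_one]
  ring

/-- For every complex `z` with `Re z > 1`, the alternating Kurepa function satisfies
`A(z) + A(z−1) = Γ(z+1)`. -/
theorem altKurepa_add_self_sub_one (z : ℂ) (hz : 1 < z.re) :
    altKurepa z + altKurepa (z - 1) = Complex.Gamma (z + 1) := by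
  have hexp : Complex.exp ((Real.pi : ℂ) * Complex.I * (z - 1)) =
      -Complex.exp ((Real.pi : ℂ) * Complex.I * z) := by
    rw [mul_sub, mul_one, Complex.exp_sub, Complex.exp_pi_mul_I, div_neg, div_one]
  rw [altKurepa, altKurepa, ← integral_add
    (integrableOn_altKurepa_integrand (by linarith))
    (integrableOn_altKurepa_integrand (by simp; linarith)),
    Complex.Gamma_eq_integral (by simp; linarith), Complex.GammaIntegral]
  refine setIntegral_congr_fun measurableSet_Ioi fun t (ht : 0 < t) => ?_
  have ht0 : (t : ℂ) ≠ 0 := Complex.ofReal_ne_zero.mpr ht.ne'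
  have ht1 : (t : ℂ) + 1 ≠ 0 := by exact_mod_cast (by linarith : (0 : ℝ) < t + 1).ne'
  simp only [hexp, sub_add_cancel, add_sub_cancel_right, Complex.cpow_add _ _ ht0,
    Complex.cpow_one]
  field_simp
  ring
end

section
/- For each natural number n ≥ 1 and every complex number z, the polynomial pₙ satisfies the explicit formula pₙ(z) = (−1)ⁿ · (1 + Σ_{j=0}^{n−1} Π_{i=0}^{j} (−1)^{j−1}·(z − n + i + 1)), where the factor (−1)^{j−1} appears in each of the j+1 terms of the product (equivalently, pₙ(z) = (−1)ⁿ·(1 + Σ_{j=0}^{n−1} (−1)^{(j−1)(j+1)} Π_{i=0}^{j} (z − n + i + 1))). -/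
/-- The polynomials `pₙ`, defined recursively by `p₀(z) = 1` and
`pₙ(z) = (z − n + 1)·pₙ₋₁(z) + (−1)ⁿ` for `n ≥ 1`. -/
noncomputable def kurepaP : ℕ → ℂ → ℂ
  | 0, _ => 1
  | (n + 1), z => (z - ((n : ℂ) + 1) + 1) * kurepaP n z + (-1 : ℂ) ^ (n + 1)

/-- The constant sign `(-1) ^ (j - 1)`, taken `j + 1` times, amounts to `(-1) ^ (j + 1)`. -/
lemma prod_range_succ_neg_one_zpow_mul (j : ℕ) (f : ℕ → ℂ) :
    ∏ i ∈ Finset.range (j + 1), ((-1 : ℂ) ^ ((j : ℤ) - 1) * f i) =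
      (-1 : ℂ) ^ (j + 1) * ∏ i ∈ Finset.range (j + 1), f i := by
  have hsign : (-1 : ℂ) ^ ((j : ℤ) - 1) = (-1) ^ (j + 1) := by
    rw [zpow_sub_one₀ (by norm_num), zpow_natCast, pow_succ]
    norm_num
  rw [Finset.prod_mul_distrib, Finset.prod_const, Finset.card_range, hsign]
  congr 1
  rcases Nat.even_or_odd (j + 1) with h | h
  · rw [h.neg_one_pow, one_pow]
  · rw [h.neg_one_pow, h.neg_one_pow]

lemma kurepaP_eq_sum_prod (n : ℕ) (z : ℂ) :
    kurepaP n z =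
      (-1 : ℂ) ^ n * (1 + ∑ j ∈ Finset.range n,
        (-1 : ℂ) ^ (j + 1) * ∏ i ∈ Finset.range (j + 1), (z - (n : ℂ) + (i : ℂ) + 1)) := by
  induction n with
  | zero => simp [kurepaP]
  | succ n ih =>
    have hterm (j : ℕ) :
        (-1 : ℂ) ^ (j + 1 + 1) * ∏ i ∈ Finset.range (j + 1 + 1),
            (z - ((n + 1 : ℕ) : ℂ) + (i : ℂ) + 1) =
          -(z - n) * ((-1 : ℂ) ^ (j + 1) *
            ∏ i ∈ Finset.range (j + 1), (z - (n : ℂ) + (i : ℂ) + 1)) := by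
      have hshift (i : ℕ) :
          z - ((n + 1 : ℕ) : ℂ) + ((i + 1 : ℕ) : ℂ) + 1 = z - n + i + 1 := by
        push_cast
        ring
      rw [Finset.prod_range_succ', Finset.prod_congr rfl fun i _ => hshift i]
      push_cast
      ring
    rw [kurepaP, ih, Finset.sum_range_succ', Finset.sum_congr rfl fun j _ => hterm j,
      ← Finset.mul_sum, zero_add, Finset.prod_range_one]
    push_cast
    ring

/-- For each `n ≥ 1` and every complex `z`,
`pₙ(z) = (−1)ⁿ · (1 + Σ_{j=0}^{n−1} Π_{i=0}^{j} (−1)^{j−1}·(z − n + i + 1))`. -/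
theorem kurepaP_explicit (n : ℕ) (hn : 1 ≤ n) (z : ℂ) :
    kurepaP n z =
      (-1 : ℂ) ^ n * (1 + ∑ j ∈ Finset.range n,
        ∏ i ∈ Finset.range (j + 1), ((-1 : ℂ) ^ ((j : ℤ) - 1) * (z - (n : ℂ) + (i : ℂ) + 1))) := by
  rw [kurepaP_eq_sum_prod]
  simp only [prod_range_succ_neg_one_zpow_mul]
end

section
/- For each natural number n ≥ 1 and every complex number z with Re z > n, it holds that A(z) = (−1)ⁿ·A(z − n) + pₙ₋₁(z)·Γ(z − n + 2). -/
open MeasureTheory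

theorem integrableOn_exp_neg_mul_cpow_div_add_one {s : ℂ} (hs : -1 < s.re) :
    IntegrableOn (fun t : ℝ => (Real.exp (-t) : ℂ) * (t : ℂ) ^ s / ((t : ℂ) + 1))
      (Set.Ioi 0) := by
  have hg := Complex.GammaIntegral_convergent (s := s + 1) (by simp; linarith)
  simp only [add_sub_cancel_right] at hg
  refine Integrable.mono hg ?_ ?_
  · refine hg.aestronglyMeasurable.mul (Measurable.aestronglyMeasurable ?_)
    fun_prop
  · filter_upwards [ae_restrict_mem measurableSet_Ioi] with t ht
    rw [norm_div]
    refine div_le_self (norm_nonneg _) ?_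
    have ht' : (0 : ℝ) < t := ht
    have : ‖(t : ℂ) + 1‖ = t + 1 := by
      rw [← Complex.ofReal_one, ← Complex.ofReal_add, Complex.norm_real, Real.norm_eq_abs,
        abs_of_pos (by linarith)]
    linarith

theorem altKurepa_add_altKurepa_sub_one {z : ℂ} (hz : -1 < z.re) :
    altKurepa z + altKurepa (z - 1) = Complex.Gamma (z + 1) := by
  have hexp : Complex.exp ((Real.pi : ℂ) * Complex.I * (z - 1)) =
      -Complex.exp ((Real.pi : ℂ) * Complex.I * z) := by
    rw [mul_sub, mul_one, Complex.exp_sub, Complex.exp_pi_mul_I, div_neg, div_one]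
  rw [altKurepa, altKurepa,
    ← integral_add (integrableOn_altKurepa_integrand (by linarith))
      (integrableOn_altKurepa_integrand (by simp; linarith)),
    Complex.Gamma_eq_integral (by simp; linarith), Complex.GammaIntegral]
  refine setIntegral_congr_fun measurableSet_Ioi fun t ht => ?_
  have ht' : (0 : ℝ) < t := ht
  have h0 : (t : ℂ) ≠ 0 := by exact_mod_cast ht'.ne'
  have h1 : (t : ℂ) + 1 ≠ 0 := by exact_mod_cast (by linarith : t + 1 ≠ 0)
  simp only [hexp, sub_add_cancel, add_sub_cancel_right, Complex.cpow_add _ _ h0,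
    Complex.cpow_one]
  field_simp
  ring

/-- For each `n ≥ 1` and every complex `z` with `Re z > n`,
`A(z) = (−1)ⁿ·A(z − n) + pₙ₋₁(z)·Γ(z − n + 2)`. -/
theorem altKurepa_eq_shift_kurepaP (n : ℕ) (hn : 1 ≤ n) (z : ℂ) (hz : (n : ℝ) < z.re) :
    altKurepa z =
      (-1 : ℂ) ^ n * altKurepa (z - (n : ℂ)) +
        kurepaP (n - 1) z * Complex.Gamma (z - (n : ℂ) + 2) := by
  induction n, hn using Nat.le_induction with
  | base =>
    have h := altKurepa_add_altKurepa_sub_one (z := z) (by push_cast at hz; linarith)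
    have e : z - ((1 : ℕ) : ℂ) + 2 = z + 1 := by push_cast; ring
    rw [e]
    simp only [kurepaP, Nat.sub_self, Nat.cast_one, pow_one, one_mul]
    linear_combination h
  | succ n hn ih =>
    push_cast at hz
    have h := altKurepa_add_altKurepa_sub_one (z := z - n) (by simp; linarith)
    have hg : Complex.Gamma (z - n + 2) = (z - n + 1) * Complex.Gamma (z - n + 1) := by
      rw [← Complex.Gamma_add_one]
      · congr 1; ring
      · intro h0
        have := congrArg Complex.re h0
        simp at this
        linarith
    obtain ⟨m, rfl⟩ := Nat.exists_eq_add_of_le' hn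
    rw [ih (by linarith), hg]
    have e₁ : z - ((m + 1 + 1 : ℕ) : ℂ) = z - ((m + 1 : ℕ) : ℂ) - 1 := by push_cast; ring
    have e₂ : z - ((m + 1 + 1 : ℕ) : ℂ) + 2 = z - ((m + 1 : ℕ) : ℂ) + 1 := by push_cast; ring
    rw [e₂, e₁]
    simp only [Nat.add_sub_cancel, kurepaP]
    push_cast at h ⊢
    linear_combination (-1 : ℂ) ^ (m + 1) * h
end

section
/- For each natural number n ≥ 1 and every complex number z outside the set {−1, 0, 1, …, n−2}, the rational function qₙ satisfies the explicit formula qₙ(z) = (−1)ⁿ · (1 + Σ_{j=1}^{n} Π_{i=1}^{j} (−1)^j/(z + 2 − i)), where the factor (−1)^j appears in each of the j terms of the product (equivalently, qₙ(z) = (−1)ⁿ·(1 + Σ_{j=1}^{n} (−1)^{j²} Π_{i=1}^{j} 1/(z + 2 − i))). -/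
/-- The rational functions `qₙ`: `q₁(z) = −z/(z+1)`, `q₂(z) = (z²+1)/(z(z+1))`, and
`qₙ(z) = −((z−n+1)/(z−n+2))·qₙ₋₁(z) + (1/(z−n+2))·qₙ₋₂(z)` for `n ≥ 3`.
(The value of `q₀` is an irrelevant junk value.) -/
noncomputable def kurepaQ : ℕ → ℂ → ℂ
  | 0, _ => 1
  | 1, z => -z / (z + 1)
  | 2, z => (z ^ 2 + 1) / (z * (z + 1))
  | (n + 3), z =>
      -((z - ((n : ℂ) + 3) + 1) / (z - ((n : ℂ) + 3) + 2)) * kurepaQ (n + 2) z +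
        (1 / (z - ((n : ℂ) + 3) + 2)) * kurepaQ (n + 1) z

/-- Consecutive products in the explicit formula differ by the factor `-1 / (z + 1 - j)`. -/
theorem prod_neg_one_pow_div_succ (z : ℂ) (j : ℕ) :
    ∏ i ∈ Finset.Icc 1 (j + 1), ((-1 : ℂ) ^ (j + 1) / (z + 2 - (i : ℂ))) =
      -(∏ i ∈ Finset.Icc 1 j, ((-1 : ℂ) ^ j / (z + 2 - (i : ℂ)))) / (z + 1 - (j : ℂ)) := by
  have hsign (k : ℕ) : ((-1 : ℂ) ^ k) ^ k = (-1) ^ k := by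
    rcases Nat.even_or_odd k with h | h <;> simp [h.neg_one_pow]
  simp only [Finset.prod_div_distrib, Finset.prod_const, Nat.card_Icc, Nat.add_sub_cancel, hsign]
  rw [Finset.prod_Icc_succ_top (by omega), pow_succ, mul_neg_one, neg_div, neg_div, div_div]
  push_cast
  ring_nf

/-- For each `n ≥ 1` and every complex `z` outside `{−1, 0, 1, …, n−2}`,
`qₙ(z) = (−1)ⁿ · (1 + Σ_{j=1}^{n} Π_{i=1}^{j} (−1)^j/(z + 2 − i))`. -/
theorem kurepaQ_explicit (n : ℕ) (hn : 1 ≤ n) (z : ℂ)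
    (hz : ∀ m : ℤ, -1 ≤ m → m ≤ (n : ℤ) - 2 → z ≠ (m : ℂ)) :
    kurepaQ n z =
      (-1 : ℂ) ^ n * (1 + ∑ j ∈ Finset.Icc 1 n,
        ∏ i ∈ Finset.Icc 1 j, ((-1 : ℂ) ^ j / (z + 2 - (i : ℂ)))) := by
  induction n using Nat.strong_induction_on with
  | _ n ih =>
    match n, hn with
    | 1, _ =>
      have h : z + 1 ≠ 0 := fun h => hz (-1) (by simp) (by simp)
        (by push_cast; linear_combination h)
      have h' : z + 2 - 1 ≠ 0 := by convert h using 1; ring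
      simp [kurepaQ]
      field_simp
      ring
    | 2, _ =>
      have h : z + 1 ≠ 0 := fun h => hz (-1) (by simp) (by simp)
        (by push_cast; linear_combination h)
      have h0 : z ≠ 0 := fun h => hz 0 (by simp) (by simp) (by simpa using h)
      have h' : z + 2 - 1 ≠ 0 := by convert h using 1; ring
      simp [kurepaQ, Finset.sum_Icc_succ_top, Finset.prod_Icc_succ_top]
      field_simp
      ring
    | k + 3, _ =>
      have ha : z - ((k : ℂ) + 3) + 2 ≠ 0 := fun h =>
        hz (k + 1) (by omega) (by push_cast; omega) (by push_cast; linear_combination h)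
      have hb : z + 1 - ((k : ℂ) + 2) ≠ 0 := by convert ha using 1; ring
      rw [kurepaQ,
        ih (k + 2) (by omega) (by omega)
          fun m h₁ h₂ => hz m h₁ (by push_cast at h₂ ⊢; omega),
        ih (k + 1) (by omega) (by omega)
          fun m h₁ h₂ => hz m h₁ (by push_cast at h₂ ⊢; omega),
        Finset.sum_Icc_succ_top (b := k + 2) (by omega),
        Finset.sum_Icc_succ_top (b := k + 1) (by omega),
        prod_neg_one_pow_div_succ z (k + 2)]
      generalize ∏ i ∈ Finset.Icc 1 (k + 1 + 1), ((-1 : ℂ) ^ (k + 1 + 1) / (z + 2 - (i : ℂ))) = P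
      generalize ∑ j ∈ Finset.Icc 1 (k + 1),
        ∏ i ∈ Finset.Icc 1 j, ((-1 : ℂ) ^ j / (z + 2 - (i : ℂ))) = S
      push_cast
      field_simp
      ring
end

section
/- For each natural number n ≥ 1 and every complex number z outside the set {−1, 0, 1, …, n−2}, the rational function rₙ satisfies the explicit formula rₙ(z) = (−1)^{n−1} · Σ_{j=1}^{n} Π_{i=1}^{j} (−1)^j/(z + 2 − i), where the factor (−1)^j appears in each of the j terms of the product (equivalently, rₙ(z) = (−1)^{n−1}·Σ_{j=1}^{n} (−1)^{j²} Π_{i=1}^{j} 1/(z + 2 − i)). -/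
/-- The rational functions `rₙ`: `r₁(z) = −1/(z+1)`, `r₂(z) = (z−1)/(z(z+1))`, and
`rₙ(z) = −((z−n+1)/(z−n+2))·rₙ₋₁(z) + (1/(z−n+2))·rₙ₋₂(z)` for `n ≥ 3`.
(The value of `r₀` is an irrelevant junk value.) -/
noncomputable def kurepaR : ℕ → ℂ → ℂ
  | 0, _ => 0
  | 1, z => -1 / (z + 1)
  | 2, z => (z - 1) / (z * (z + 1))
  | (n + 3), z =>
      -((z - ((n : ℂ) + 3) + 1) / (z - ((n : ℂ) + 3) + 2)) * kurepaR (n + 2) z +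
        (1 / (z - ((n : ℂ) + 3) + 2)) * kurepaR (n + 1) z

/-- The `j`-th summand of the explicit formula, with its sign pulled out of the product. -/
theorem prod_neg_one_pow_div (z : ℂ) (j : ℕ) :
    ∏ i ∈ Finset.Icc 1 j, ((-1 : ℂ) ^ j / (z + 2 - (i : ℂ))) =
      (-1 : ℂ) ^ j * ∏ i ∈ Finset.Icc 1 j, (z + 2 - (i : ℂ))⁻¹ := by
  have hsign : ((-1 : ℂ) ^ j) ^ j = (-1 : ℂ) ^ j := by
    rcases Nat.even_or_odd j with h | h <;> simp [h.neg_one_pow]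
  simp [div_eq_mul_inv, Finset.prod_mul_distrib, hsign]

/-- For each `n ≥ 1` and every complex `z` outside `{−1, 0, 1, …, n−2}`,
`rₙ(z) = (−1)^{n−1} · Σ_{j=1}^{n} Π_{i=1}^{j} (−1)^j/(z + 2 − i)`. -/
theorem kurepaR_explicit (n : ℕ) (hn : 1 ≤ n) (z : ℂ)
    (hz : ∀ m : ℤ, -1 ≤ m → m ≤ (n : ℤ) - 2 → z ≠ (m : ℂ)) :
    kurepaR n z =
      (-1 : ℂ) ^ (n - 1) * ∑ j ∈ Finset.Icc 1 n,
        ∏ i ∈ Finset.Icc 1 j, ((-1 : ℂ) ^ j / (z + 2 - (i : ℂ))) := by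
  induction n using Nat.strong_induction_on with
  | _ n ih =>
    match n, hn with
    | 1, _ =>
      have h : z + 2 - 1 = z + 1 := by ring
      simp [kurepaR, h]
    | 2, _ =>
      have h0 : z ≠ 0 := by simpa using hz 0 (by norm_num) (by norm_num)
      have h1 : z + 1 ≠ 0 := fun h =>
        hz (-1) le_rfl (by norm_num) (by push_cast; linear_combination h)
      have h : z + 2 - 1 = z + 1 := by ring
      simp only [kurepaR, prod_neg_one_pow_div]
      norm_num [Finset.sum_Icc_succ_top, Finset.prod_Icc_succ_top, h]
      field_simp
      ring
    | k + 3, _ =>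
      have hw : z - ((k : ℂ) + 3) + 2 ≠ 0 := fun h =>
        hz (k + 1) (by lia) (by push_cast; lia) (by push_cast; linear_combination h)
      have hlast : z + 2 - ((k + 3 : ℕ) : ℂ) = z - ((k : ℂ) + 3) + 2 := by
        push_cast; ring
      rw [kurepaR,
        ih (k + 2) (by lia) (by lia) fun m hm hm' => hz m hm (by push_cast at hm' ⊢; lia),
        ih (k + 1) (by lia) (by lia) fun m hm hm' => hz m hm (by push_cast at hm' ⊢; lia)]
      simp only [prod_neg_one_pow_div]
      rw [Finset.sum_Icc_succ_top (show 1 ≤ k + 2 + 1 by lia),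
        Finset.sum_Icc_succ_top (show 1 ≤ k + 1 + 1 by lia),
        Finset.prod_Icc_succ_top (show 1 ≤ k + 2 + 1 by lia), hlast]
      simp only [show k + 2 - 1 = k + 1 from rfl, show k + 1 - 1 = k from rfl,
        show k + 3 - 1 = k + 2 from rfl, pow_succ]
      field_simp
      ring
end

section
/- For each natural number n ≥ 1 and every complex number z outside the set {−1, 0, 1, …, n−2}, it holds that rₙ(z) = (−1)ⁿ − qₙ(z). -/
/-- For each `n ≥ 1` and every complex `z` outside `{−1, 0, 1, …, n−2}`,
`rₙ(z) = (−1)ⁿ − qₙ(z)`. -/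
theorem kurepaR_eq_neg_one_pow_sub_kurepaQ (n : ℕ) (hn : 1 ≤ n) (z : ℂ)
    (hz : ∀ m : ℤ, -1 ≤ m → m ≤ (n : ℤ) - 2 → z ≠ (m : ℂ)) :
    kurepaR n z = (-1 : ℂ) ^ n - kurepaQ n z := by
  induction n using Nat.strong_induction_on with
  | _ n ih =>
    match n, hn with
    | 1, _ =>
      have h : z + 1 ≠ 0 := fun h =>
        hz (-1) le_rfl (by norm_num) (by push_cast; linear_combination h)
      simp only [kurepaR, kurepaQ]
      field_simp
      ring
    | 2, _ =>
      have h : z + 1 ≠ 0 := fun h =>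
        hz (-1) le_rfl (by norm_num) (by push_cast; linear_combination h)
      have h0 : z ≠ 0 := by simpa using hz 0 (by norm_num) (by norm_num)
      simp only [kurepaR, kurepaQ]
      field_simp
      ring
    | k + 3, _ =>
      have hw : z - ((k : ℂ) + 3) + 2 ≠ 0 := fun h =>
        hz (k + 1) (by omega) (by push_cast; omega) (by push_cast; linear_combination h)
      have h₂ := ih (k + 2) (by omega) (by omega)
        fun m hm hm' => hz m hm (by push_cast at hm' ⊢; omega)
      have h₁ := ih (k + 1) (by omega) (by omega)
        fun m hm hm' => hz m hm (by push_cast at hm' ⊢; omega)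
      simp only [kurepaR, kurepaQ]
      rw [h₁, h₂]
      field_simp
      ring
end

section
/- The function β(x) = ∫₀^∞ e^{−t} t^{x+1}/(t+1) dt is positive and strictly convex on the interval (−2, ∞), tends to +∞ as x → −2⁺ and as x → +∞, attains a global minimum at a unique point x₀ ∈ (−2, ∞), and satisfies β(x) ≥ β(x₀) > 0.401 for all x ∈ (−2, ∞). -/
open MeasureTheory Filter

/-- `β(x) = ∫₀^∞ e^{−t} t^{x+1}/(t+1) dt`, convergent for `x > −2`. -/
noncomputable def kurepaBeta (x : ℝ) : ℝ :=
  ∫ t in Set.Ioi (0 : ℝ), Real.exp (-t) * t ^ (x + 1) / (t + 1)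

/-- The integrand defining `kurepaBeta x` is integrable on the positive half-line. -/
lemma kurepaBeta_integrableOn {x : ℝ} (hx : -2 < x) :
    IntegrableOn (fun t : ℝ => Real.exp (-t) * t ^ (x + 1) / (t + 1)) (Set.Ioi 0) := by
  have h := Real.GammaIntegral_convergent (s := x + 2) (by linarith)
  rw [show x + 2 - 1 = x + 1 by ring] at h
  refine Integrable.mono' h ?_ ?_
  · exact h.aestronglyMeasurable.div₀
      (measurable_id.add_const (1 : ℝ)).aestronglyMeasurable
  · filter_upwards [ae_restrict_mem measurableSet_Ioi] with t ht
    have ht' : 0 < t := ht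
    rw [Real.norm_of_nonneg (by positivity)]
    exact div_le_self (by positivity) (by linarith)

lemma setIntegral_Ioi_lt {f g : ℝ → ℝ} (hf : IntegrableOn f (Set.Ioi 0))
    (hg : IntegrableOn g (Set.Ioi 0)) (hle : ∀ t ∈ Set.Ioi (0 : ℝ), f t ≤ g t)
    (hlt : ∀ t ∈ Set.Ioi (1 : ℝ), f t < g t) :
    ∫ t in Set.Ioi (0 : ℝ), f t < ∫ t in Set.Ioi (0 : ℝ), g t := by
  rw [← sub_pos, ← integral_sub hg hf, integral_pos_iff_support_of_nonneg_ae
    ((ae_restrict_mem measurableSet_Ioi).mono fun t ht => sub_nonneg.mpr (hle t ht)) (hg.sub hf)]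
  have h1 : 0 < (volume.restrict (Set.Ioi (0 : ℝ))) (Set.Ioi 1) := by
    rw [Measure.restrict_apply measurableSet_Ioi,
      Set.inter_eq_left.mpr (Set.Ioi_subset_Ioi zero_le_one)]
    simp
  exact h1.trans_le (measure_mono fun t ht => (sub_pos.mpr (hlt t ht)).ne')

lemma kurepaBeta_pos {x : ℝ} (hx : -2 < x) : 0 < kurepaBeta x := by
  have h := setIntegral_Ioi_lt (f := fun _ => 0) integrableOn_zero (kurepaBeta_integrableOn hx)
    (fun t ht => by have ht' : 0 < t := ht; positivity)
    (fun t ht => by have ht' : 0 < t := lt_trans one_pos ht; positivity)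
  simpa [kurepaBeta] using h

lemma kurepaBeta_strictConvexOn : StrictConvexOn ℝ (Set.Ioi (-2 : ℝ)) kurepaBeta := by
  refine ⟨convex_Ioi _, fun x hx y hy hxy a b ha hb hab => ?_⟩
  have hz : -2 < a • x + b • y := (convex_Ioi (-2 : ℝ)) hx hy ha.le hb.le hab
  have ix := (kurepaBeta_integrableOn hx).const_mul a
  have iy := (kurepaBeta_integrableOn hy).const_mul b
  have hrpow (t : ℝ) (ht : 0 < t) : t ^ (a • x + b • y + 1) =
      Real.exp (a • (Real.log t * (x + 1)) + b • (Real.log t * (y + 1))) := by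
    rw [Real.rpow_def_of_pos ht]
    congr 1
    simp only [smul_eq_mul]
    linear_combination -Real.log t * hab
  have hcomb (t : ℝ) : a * (Real.exp (-t) * t ^ (x + 1) / (t + 1)) +
      b * (Real.exp (-t) * t ^ (y + 1) / (t + 1)) =
      Real.exp (-t) * (a * t ^ (x + 1) + b * t ^ (y + 1)) / (t + 1) := by ring
  have key := setIntegral_Ioi_lt (kurepaBeta_integrableOn hz) (ix.add iy)
    (fun t ht => by
      have ht' : 0 < t := ht
      simp only [Pi.add_apply]
      rw [hcomb, hrpow t ht', Real.rpow_def_of_pos ht', Real.rpow_def_of_pos ht']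
      have := convexOn_exp.2 (Set.mem_univ (Real.log t * (x + 1)))
        (Set.mem_univ (Real.log t * (y + 1))) ha.le hb.le hab
      simp only [smul_eq_mul] at this ⊢
      gcongr)
    (fun t ht => by
      have ht' : 0 < t := lt_trans one_pos ht
      simp only [Pi.add_apply]
      rw [hcomb, hrpow t ht', Real.rpow_def_of_pos ht', Real.rpow_def_of_pos ht']
      have hlog : Real.log t ≠ 0 := (Real.log_pos ht).ne'
      have := strictConvexOn_exp.2 (Set.mem_univ (Real.log t * (x + 1)))
        (Set.mem_univ (Real.log t * (y + 1))) (by simpa [hlog] using hxy) ha hb hab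
      simp only [smul_eq_mul] at this ⊢
      gcongr)
  simp only [Pi.add_apply] at key
  rw [integral_add ix iy, integral_const_mul, integral_const_mul] at key
  simpa [kurepaBeta] using key

lemma kurepaBeta_add_kurepaBeta_sub_one {x : ℝ} (hx : -1 < x) :
    kurepaBeta x + kurepaBeta (x - 1) = Real.Gamma (x + 1) := by
  unfold kurepaBeta
  rw [← integral_add (kurepaBeta_integrableOn (by linarith))
    (kurepaBeta_integrableOn (by linarith)), Real.Gamma_eq_integral (by linarith)]
  refine setIntegral_congr_fun measurableSet_Ioi fun t ht => ?_
  have ht' : 0 < t := ht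
  have h1 : t ^ (x + 1) = t ^ x * t := Real.rpow_add_one ht'.ne' x
  simp only [sub_add_cancel, add_sub_cancel_right, h1]
  field_simp

lemma kurepaBeta_neg_one : kurepaBeta (-1) = kurepaBeta 1 := by
  have h0 := kurepaBeta_add_kurepaBeta_sub_one (x := 0) (by norm_num)
  have h1 := kurepaBeta_add_kurepaBeta_sub_one (x := 1) (by norm_num)
  norm_num at h0 h1
  linarith

lemma tendsto_kurepaBeta_neg_two :
    Tendsto kurepaBeta (nhdsWithin (-2 : ℝ) (Set.Ioi (-2 : ℝ))) atTop := by
  have hlim : Tendsto (fun x : ℝ => Real.exp (-1) / 2 * (x + 2)⁻¹)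
      (nhdsWithin (-2 : ℝ) (Set.Ioi (-2 : ℝ))) atTop := by
    refine Tendsto.const_mul_atTop (by positivity) (tendsto_inv_nhdsGT_zero.comp ?_)
    refine tendsto_nhdsWithin_iff.mpr ⟨?_, ?_⟩
    · have : Tendsto (fun x : ℝ => x + 2) (nhds (-2)) (nhds (-2 + 2)) :=
        tendsto_id.add_const 2
      rw [neg_add_cancel] at this
      exact this.mono_left nhdsWithin_le_nhds
    · filter_upwards [self_mem_nhdsWithin] with x hx
      have hx' : -2 < x := hx
      exact Set.mem_Ioi.mpr (by linarith)
  refine tendsto_atTop_mono' _ ?_ hlim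
  filter_upwards [self_mem_nhdsWithin] with x hx
  have hx' : -2 < x := hx
  have hint := intervalIntegral.intervalIntegrable_rpow' (a := 0) (b := 1) (r := x + 1)
    (by linarith)
  have hpow : ∫ t in (0 : ℝ)..1, t ^ (x + 1) = (x + 2)⁻¹ := by
    rw [integral_rpow (Or.inl (by linarith)), Real.one_rpow,
      Real.zero_rpow (by linarith : x + 1 + 1 ≠ 0)]
    rw [sub_zero, one_div, add_assoc]
    norm_num
  rw [← hpow, ← intervalIntegral.integral_const_mul,
    intervalIntegral.integral_of_le zero_le_one]
  have hi := kurepaBeta_integrableOn hx'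
  calc ∫ t in Set.Ioc (0 : ℝ) 1, Real.exp (-1) / 2 * t ^ (x + 1)
      ≤ ∫ t in Set.Ioc (0 : ℝ) 1, Real.exp (-t) * t ^ (x + 1) / (t + 1) := by
        refine setIntegral_mono_on (hint.1.const_mul _) (hi.mono_set Set.Ioc_subset_Ioi_self)
          measurableSet_Ioc fun t ht => ?_
        have h0 : 0 < t := ht.1
        have h1 : t ≤ 1 := ht.2
        rw [div_mul_eq_mul_div]
        gcongr
        linarith
    _ ≤ kurepaBeta x := by
        refine setIntegral_mono_set hi ?_ Set.Ioc_subset_Ioi_self.eventuallyLE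
        filter_upwards [ae_restrict_mem measurableSet_Ioi] with t ht
        have ht' : 0 < t := ht
        simp only [Pi.zero_apply]
        positivity

lemma tendsto_kurepaBeta_atTop : Tendsto kurepaBeta atTop atTop := by
  have hlim : Tendsto (fun x : ℝ => Real.exp (-3) / 4 * (2 : ℝ) ^ x) atTop atTop :=
    Tendsto.const_mul_atTop (by positivity) (tendsto_rpow_atTop_of_base_gt_one 2 one_lt_two)
  refine tendsto_atTop_mono' _ ?_ hlim
  filter_upwards [eventually_gt_atTop 0] with x hx
  have hi := kurepaBeta_integrableOn (x := x) (by linarith)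
  have hsub : Set.Ioc (2 : ℝ) 3 ⊆ Set.Ioi 0 := fun t ht => lt_trans two_pos ht.1
  calc Real.exp (-3) / 4 * (2 : ℝ) ^ x
      = ∫ _ in Set.Ioc (2 : ℝ) 3, Real.exp (-3) / 4 * (2 : ℝ) ^ x := by
        rw [setIntegral_const]
        norm_num
    _ ≤ ∫ t in Set.Ioc (2 : ℝ) 3, Real.exp (-t) * t ^ (x + 1) / (t + 1) := by
        refine setIntegral_mono_on (integrableOn_const (by simp)) (hi.mono_set hsub)
          measurableSet_Ioc fun t ht => ?_
        have h2 : 2 < t := ht.1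
        have h3 : t ≤ 3 := ht.2
        have hp : (2 : ℝ) ^ x ≤ t ^ (x + 1) :=
          (Real.rpow_le_rpow_of_exponent_le one_le_two (by linarith)).trans
            (Real.rpow_le_rpow two_pos.le h2.le (by linarith))
        rw [div_mul_eq_mul_div]
        gcongr
        linarith
    _ ≤ kurepaBeta x := by
        refine setIntegral_mono_set hi ?_ hsub.eventuallyLE
        filter_upwards [ae_restrict_mem measurableSet_Ioi] with t ht
        have ht' : 0 < t := ht
        simp only [Pi.zero_apply]
        positivity

lemma kurepaBeta_one_le {x : ℝ} (hx : 1 ≤ x) : kurepaBeta 1 ≤ kurepaBeta x := by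
  rcases hx.eq_or_lt with rfl | hx
  · rfl
  by_contra! hlt
  have h := kurepaBeta_strictConvexOn.slope_strict_mono_adjacent
    (x := -1) (y := 1) (z := x) (by norm_num) (Set.mem_Ioi.mpr (by linarith)) (by norm_num) hx
  rw [kurepaBeta_neg_one, sub_self, zero_div] at h
  exact absurd (div_neg_of_neg_of_pos (sub_neg.mpr hlt) (sub_pos.mpr hx)) h.not_gt

lemma kurepaBeta_one_le_of_le {x : ℝ} (hx2 : -2 < x) (hx : x ≤ -1) :
    kurepaBeta 1 ≤ kurepaBeta x := by
  rcases hx.eq_or_lt with rfl | hx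
  · exact kurepaBeta_neg_one.ge
  by_contra! hlt
  have h := kurepaBeta_strictConvexOn.slope_strict_mono_adjacent
    (x := x) (y := -1) (z := 1) hx2 (by norm_num) hx (by norm_num)
  rw [kurepaBeta_neg_one, sub_self, zero_div] at h
  exact absurd (div_pos (sub_pos.mpr hlt) (sub_pos.mpr hx)) h.not_gt

lemma exists_kurepaBeta_min :
    ∃ x₀ ∈ Set.Icc (-1 : ℝ) 1, ∀ x ∈ Set.Ioi (-2 : ℝ), kurepaBeta x₀ ≤ kurepaBeta x := by
  have hc : ContinuousOn kurepaBeta (Set.Icc (-1) 1) :=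
    (kurepaBeta_strictConvexOn.convexOn.continuousOn isOpen_Ioi).mono
      fun x hx => Set.mem_Ioi.mpr (by linarith [hx.1])
  obtain ⟨x₀, hx₀, hmin⟩ := isCompact_Icc.exists_isMinOn ⟨0, by norm_num⟩ hc
  refine ⟨x₀, hx₀, fun x hx => ?_⟩
  have h1 : kurepaBeta x₀ ≤ kurepaBeta 1 := hmin (by norm_num)
  rcases le_total x (-1) with h | h
  · exact h1.trans (kurepaBeta_one_le_of_le hx h)
  rcases le_total 1 x with h' | h'
  · exact h1.trans (kurepaBeta_one_le h')
  · exact hmin ⟨h, h'⟩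

/-- Integrals of polynomials against the Gamma weight `e^{-t} t^{s-1}`. -/
lemma integral_Gamma_weight_mul_sum (n : ℕ) (a : Fin n → ℝ) {s : ℝ} (hs : 0 < s) :
    IntegrableOn (fun t : ℝ => Real.exp (-t) * t ^ (s - 1) * ∑ k, a k * t ^ (k : ℕ))
      (Set.Ioi 0) ∧
    ∫ t in Set.Ioi (0 : ℝ), Real.exp (-t) * t ^ (s - 1) * ∑ k, a k * t ^ (k : ℕ) =
      Real.Gamma s * ∑ k, a k * (ascPochhammer ℝ k).eval s := by
  have hi (k : Fin n) : IntegrableOn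
      (fun t : ℝ => a k * (Real.exp (-t) * t ^ (s + (k : ℕ) - 1))) (Set.Ioi 0) :=
    (Real.GammaIntegral_convergent (by positivity)).const_mul _
  have heq : Set.EqOn (fun t : ℝ => Real.exp (-t) * t ^ (s - 1) * ∑ k, a k * t ^ (k : ℕ))
      (fun t => ∑ k : Fin n, a k * (Real.exp (-t) * t ^ (s + (k : ℕ) - 1))) (Set.Ioi 0) := by
    intro t ht
    have ht' : 0 < t := ht
    simp only [Finset.mul_sum]
    refine Finset.sum_congr rfl fun k _ => ?_
    rw [show s + ((k : ℕ) : ℝ) - 1 = s - 1 + ((k : ℕ) : ℝ) by ring, Real.rpow_add ht',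
      Real.rpow_natCast]
    ring
  have hG (k : ℕ) : Real.Gamma (s + k) = Real.Gamma s * (ascPochhammer ℝ k).eval s := by
    induction k with
    | zero => simp
    | succ k ih =>
      rw [Nat.cast_succ, ← add_assoc, Real.Gamma_add_one (by positivity), ih,
        ascPochhammer_succ_eval]
      ring
  refine ⟨(integrableOn_congr_fun heq measurableSet_Ioi).mpr
    (integrable_finsetSum _ fun k _ => hi k), ?_⟩
  rw [setIntegral_congr_fun measurableSet_Ioi heq, integral_finsetSum _ fun k _ => hi k,
    Finset.mul_sum]
  refine Finset.sum_congr rfl fun k _ => ?_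
  rw [integral_const_mul, ← Real.Gamma_eq_integral (by positivity), hG]
  ring

/-- Replacing `1 / (t + 1)` by its Hermite interpolant at the roots of the Laguerre polynomial
`L₇⁽¹⁾` bounds `β` from below by a polynomial multiple of the Gamma function. -/
lemma Gamma_mul_le_kurepaBeta {x : ℝ} (hx : -2 < x) :
    Real.Gamma (x + 2) * ((62738801829 - 21397814388 * x + 6301462635 * x ^ 2
      - 1661890833 * x ^ 3 + 375259500 * x ^ 4 - 80905201 * x ^ 5 + 13412727 * x ^ 6
      - 2417243 * x ^ 7 + 266220 * x ^ 8 - 40497 * x ^ 9 + 2565 * x ^ 10 - 332 * x ^ 11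
      + 9 * x ^ 12 - x ^ 13) / 155514288609) ≤ kurepaBeta x := by
  let a : Fin 14 → ℝ := ![153888586209, -142508669409, 111213898209, -66642557409, 29183664609,
    -9173977569, 2060965089, -330188769, 37505889, -2978529, 160833, -5601, 113, -1]
  obtain ⟨hi, hI⟩ := integral_Gamma_weight_mul_sum 14 a (s := x + 2) (by linarith)
  have hsum : ∑ k, a k * (ascPochhammer ℝ k).eval (x + 2) = 62738801829 - 21397814388 * x
      + 6301462635 * x ^ 2
      - 1661890833 * x ^ 3 + 375259500 * x ^ 4 - 80905201 * x ^ 5 + 13412727 * x ^ 6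
      - 2417243 * x ^ 7 + 266220 * x ^ 8 - 40497 * x ^ 9 + 2565 * x ^ 10 - 332 * x ^ 11
      + 9 * x ^ 12 - x ^ 13 := by
    simp only [a, Fin.sum_univ_succ, Fin.sum_univ_zero]
    simp [ascPochhammer_succ_eval]
    ring
  rw [hsum] at hI
  rw [mul_div_assoc', ← hI, ← integral_div]
  refine setIntegral_mono_on (hi.div_const _) (kurepaBeta_integrableOn hx) measurableSet_Ioi
    fun t ht => ?_
  have ht' : 0 < t := ht
  have hq : (∑ k, a k * t ^ (k : ℕ)) / 155514288609 ≤ 1 / (t + 1) := by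
    rw [div_le_div_iff₀ (by norm_num) (by linarith)]
    simp only [a, Fin.sum_univ_succ, Fin.sum_univ_zero]
    simp
    nlinarith [sq_nonneg (40320 - 141120 * t + 141120 * t ^ 2 - 58800 * t ^ 3 + 11760 * t ^ 4
      - 1176 * t ^ 5 + 56 * t ^ 6 - t ^ 7)]
  rw [mul_div_assoc, show x + 2 - 1 = x + 1 by ring, ← mul_one_div (_ * _) (t + 1)]
  gcongr

lemma Real.log_one_sub_le_neg_sub {y : ℝ} (h0 : 0 ≤ y) (h1 : y < 1) :
    Real.log (1 - y) ≤ -y - y ^ 2 / 2 := by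
  have h := sum_le_hasSum (Finset.range 2) (fun i _ => by positivity)
    (Real.hasSum_pow_div_log_of_abs_lt_one (abs_lt.mpr ⟨by linarith, h1⟩))
  norm_num [Finset.sum_range_succ] at h
  linarith

lemma Real.log_Gamma_add_nat {y : ℝ} (hy : 0 < y) (n : ℕ) :
    Real.log (Real.Gamma (y + n)) =
      Real.log (Real.Gamma y) + ∑ k ∈ Finset.range n, Real.log (y + k) := by
  induction n with
  | zero => simp
  | succ n ih =>
    have : 0 < y + n := by positivity
    rw [Nat.cast_succ, ← add_assoc, Real.Gamma_add_one this.ne',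
      Real.log_mul this.ne' (Real.Gamma_pos_of_pos this).ne', ih, Finset.sum_range_succ]
    ring

lemma Real.le_log_Gamma_two_sub {u : ℝ} (h0 : 0 ≤ u) (h1 : u ≤ 1) (n : ℕ) :
    u * (∑ k ∈ Finset.range n, 1 / ((k : ℝ) + 2) - Real.log (n + 2)) +
      u ^ 2 / 2 * ∑ k ∈ Finset.range n, 1 / ((k : ℝ) + 2) ^ 2 ≤
        Real.log (Real.Gamma (2 - u)) := by
  rcases h0.eq_or_lt with rfl | h0
  · simp
  have hn : (0 : ℝ) ≤ n := n.cast_nonneg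
  have hA := Real.log_Gamma_add_nat (y := 2 - u) (by linarith) n
  have hB := Real.log_Gamma_add_nat (y := 2) two_pos n
  have hC : Real.log (Real.Gamma (2 + n + 1)) =
      Real.log (2 + n) + Real.log (Real.Gamma (2 + n)) := by
    have : (0 : ℝ) < 2 + n := by positivity
    rw [Real.Gamma_add_one this.ne', Real.log_mul this.ne' (Real.Gamma_pos_of_pos this).ne']
  have hS := Real.convexOn_log_Gamma.slope_mono_adjacent (x := 2 - u + n) (y := 2 + n)
    (z := 2 + n + 1) (Set.mem_Ioi.mpr (by linarith)) (Set.mem_Ioi.mpr (by linarith))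
    (by linarith) (by linarith)
  simp only [Function.comp_apply, add_sub_cancel_left, div_one] at hS
  rw [show (2 + (n : ℝ)) - (2 - u + n) = u by ring, div_le_iff₀ h0, hC] at hS
  have hsum : ∑ k ∈ Finset.range n, Real.log (2 - u + k) ≤ ∑ k ∈ Finset.range n,
      (Real.log (2 + k) - u * (1 / ((k : ℝ) + 2)) - u ^ 2 / 2 * (1 / ((k : ℝ) + 2) ^ 2)) := by
    refine Finset.sum_le_sum fun k _ => ?_
    have hk : (0 : ℝ) < 2 + k := by positivity
    have hlt : u / (2 + k) < 1 := by
      rw [div_lt_one hk]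
      linarith [(k.cast_nonneg : (0 : ℝ) ≤ k)]
    have h := Real.log_one_sub_le_neg_sub (y := u / (2 + k)) (by positivity) hlt
    have hm : Real.log (2 - u + k) = Real.log (2 + k) + Real.log (1 - u / (2 + k)) := by
      rw [← Real.log_mul hk.ne' (by linarith)]
      congr 1
      field_simp
      ring
    rw [hm, add_comm (k : ℝ) 2]
    have e1 : u / (2 + (k : ℝ)) = u * (1 / (2 + k)) := by ring
    have e2 : (u / (2 + (k : ℝ))) ^ 2 / 2 = u ^ 2 / 2 * (1 / (2 + k) ^ 2) := by
      field_simp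
    linarith
  rw [Finset.sum_sub_distrib, Finset.sum_sub_distrib, ← Finset.mul_sum, ← Finset.mul_sum]
    at hsum
  rw [Real.Gamma_two, Real.log_one, zero_add] at hB
  rw [add_comm (n : ℝ) 2]
  linarith

lemma Real.exp_le_Gamma_two_sub {u : ℝ} (h0 : 0 ≤ u) (h1 : u ≤ 1) :
    Real.exp (-(427 / 1000) * u + 318 / 1000 * u ^ 2) ≤ Real.Gamma (2 - u) := by
  rw [← Real.le_log_iff_exp_le (Real.Gamma_pos_of_pos (by linarith))]
  have h := Real.le_log_Gamma_two_sub h0 h1 126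
  have hlog : Real.log ((126 : ℕ) + 2) = 7 * Real.log 2 := by
    rw [show ((126 : ℕ) : ℝ) + 2 = 2 ^ 7 by norm_num, Real.log_pow]
    norm_num
  have hS1 : (4.4251 : ℝ) ≤ ∑ k ∈ Finset.range 126, 1 / ((k : ℝ) + 2) := by
    norm_num [Finset.sum_range_succ]
  have hS2 : (0.636 : ℝ) ≤ ∑ k ∈ Finset.range 126, 1 / ((k : ℝ) + 2) ^ 2 := by
    norm_num [Finset.sum_range_succ]
  rw [hlog] at h
  have hl := Real.log_two_lt_d9
  have e1 := mul_le_mul_of_nonneg_left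
    (show -(427 / 1000) ≤ ∑ k ∈ Finset.range 126, 1 / ((k : ℝ) + 2) - 7 * Real.log 2 by
      linarith) h0
  have e2 := mul_le_mul_of_nonneg_left hS2 (show 0 ≤ u ^ 2 / 2 by positivity)
  linarith

lemma Real.quadratic_le_Gamma_two_add {h : ℝ} (h0 : 0 ≤ h) :
    1 + h / 3 + h ^ 2 / 18 ≤ Real.Gamma (2 + h) := by
  have hd : HasDerivAt Real.Gamma (1 - Real.eulerMascheroniConstant) 2 := by
    have := Real.hasDerivAt_Gamma_nat 1
    norm_num at this
    convert this using 1
    ring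
  have hlog : HasDerivAt (Real.log ∘ Real.Gamma) (1 - Real.eulerMascheroniConstant) 2 := by
    have := hd.log (by simp)
    rwa [Real.Gamma_two, div_one] at this
  have hle : h / 3 ≤ Real.log (Real.Gamma (2 + h)) := by
    rcases h0.eq_or_lt with rfl | h0
    · simp
    have hs := Real.convexOn_log_Gamma.le_slope_of_hasDerivAt (x := 2) (y := 2 + h)
      (by norm_num) (Set.mem_Ioi.mpr (by linarith)) (by linarith) hlog
    rw [slope_def_field, add_sub_cancel_left, le_div_iff₀ h0] at hs
    simp only [Function.comp_apply, Real.Gamma_two, Real.log_one, sub_zero] at hs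
    nlinarith [Real.eulerMascheroniConstant_lt_two_thirds]
  rw [Real.le_log_iff_exp_le (Real.Gamma_pos_of_pos (by linarith))] at hle
  have := Real.quadratic_le_exp_of_nonneg (x := h / 3) (by positivity)
  linarith

lemma lt_kurepaBeta_of_nonneg {x : ℝ} (h0 : 0 ≤ x) (h1 : x ≤ 1) : 0.401 < kurepaBeta x := by
  refine lt_of_lt_of_le ?_ (Gamma_mul_le_kurepaBeta (by linarith))
  have hG := Real.quadratic_le_Gamma_two_add h0
  rw [add_comm 2 x] at hG
  have hP : 0.4034 - 0.1376 * x + 0.0405 * x ^ 2 - 0.0107 * x ^ 3 ≤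
      (62738801829 - 21397814388 * x + 6301462635 * x ^ 2
      - 1661890833 * x ^ 3 + 375259500 * x ^ 4 - 80905201 * x ^ 5 + 13412727 * x ^ 6
      - 2417243 * x ^ 7 + 266220 * x ^ 8 - 40497 * x ^ 9 + 2565 * x ^ 10 - 332 * x ^ 11
      + 9 * x ^ 12 - x ^ 13) / 155514288609 := by
    have hp {m n : ℕ} (h : n ≤ m) : x ^ m ≤ x ^ n := pow_le_pow_of_le_one h0 h1 h
    have hn (n : ℕ) : 0 ≤ x ^ n := pow_nonneg h0 n
    rw [le_div_iff₀ (by norm_num)]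
    linarith [hp (show 4 ≤ 5 by simp), hp (show 6 ≤ 7 by simp), hp (show 8 ≤ 9 by simp),
      hp (show 10 ≤ 11 by simp), hp (show 12 ≤ 13 by simp), hn 2, hn 3, hn 4, hn 6, hn 8, hn 10, hn 12]
  have hP0 : 0 ≤ 0.4034 - 0.1376 * x + 0.0405 * x ^ 2 - 0.0107 * x ^ 3 := by
    nlinarith [sq_nonneg x, pow_le_one₀ h0 h1 (n := 3)]
  refine lt_of_lt_of_le ?_ (mul_le_mul hG hP hP0 (by linarith [sq_nonneg x]))
  nlinarith [pow_nonneg h0 2, pow_nonneg h0 3, pow_nonneg h0 4, pow_nonneg h0 5,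
    sq_nonneg (x - 0.09), mul_nonneg (pow_nonneg h0 2) (sub_nonneg.mpr h1),
    mul_nonneg (pow_nonneg h0 3) (sub_nonneg.mpr h1),
    mul_nonneg (pow_nonneg h0 4) (sub_nonneg.mpr h1)]

lemma lt_kurepaBeta_neg {u : ℝ} (h0 : 0 ≤ u) (h1 : u ≤ 1) : 0.401 < kurepaBeta (-u) := by
  refine lt_of_lt_of_le ?_ (Gamma_mul_le_kurepaBeta (by linarith))
  have hG := Real.exp_le_Gamma_two_sub h0 h1
  rw [sub_eq_add_neg, add_comm 2 (-u)] at hG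
  have hE : 1 - 0.427 * u + 0.386 * u ^ 2 - 0.107 * u ^ 3 ≤
      Real.exp (-(427 / 1000) * u + 318 / 1000 * u ^ 2) := by
    set y := (-(427 / 1000) * u + 318 / 1000 * u ^ 2) / 4 with hy
    have hexp : Real.exp (-(427 / 1000) * u + 318 / 1000 * u ^ 2) = Real.exp y ^ 4 := by
      rw [← Real.exp_nat_mul]
      congr 1
      push_cast
      ring
    have hpos : 0 ≤ y + 1 := by nlinarith [sq_nonneg u]
    have hcube : (-(427 / 4000) * u) ^ 3 ≤ y ^ 3 :=
      (Odd.strictMono_pow (by decide)).monotone (by rw [hy]; linarith [sq_nonneg u])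
    have hsq : y ^ 2 = (427 / 4000) ^ 2 * u ^ 2 - 2 * (427 / 4000) * (318 / 4000) * u ^ 3 +
        (318 / 4000) ^ 2 * u ^ 4 := by rw [hy]; ring
    have hquart : 0 ≤ y ^ 4 := by positivity
    rw [hexp]
    refine le_trans ?_ (pow_le_pow_left₀ hpos (Real.add_one_le_exp y) 4)
    have hbin : (y + 1) ^ 4 = y ^ 4 + 4 * y ^ 3 + 6 * y ^ 2 + 4 * y + 1 := by ring
    rw [hbin, hsq]
    have h2 := pow_nonneg h0 2
    have h3 := pow_nonneg h0 3
    have h4 := pow_nonneg h0 4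
    linarith
  have hP : 0.4034 + 0.1375 * u + 0.0405 * u ^ 2 ≤
      (62738801829 - 21397814388 * (-u) + 6301462635 * (-u) ^ 2
      - 1661890833 * (-u) ^ 3 + 375259500 * (-u) ^ 4 - 80905201 * (-u) ^ 5 + 13412727 * (-u) ^ 6
      - 2417243 * (-u) ^ 7 + 266220 * (-u) ^ 8 - 40497 * (-u) ^ 9 + 2565 * (-u) ^ 10
      - 332 * (-u) ^ 11 + 9 * (-u) ^ 12 - (-u) ^ 13) / 155514288609 := by
    have hn (n : ℕ) : 0 ≤ u ^ n := pow_nonneg h0 n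
    rw [le_div_iff₀ (by norm_num)]
    ring_nf
    linarith [hn 1, hn 2, hn 3, hn 4, hn 5, hn 6, hn 7, hn 8, hn 9, hn 10, hn 11, hn 12, hn 13]
  refine lt_of_lt_of_le ?_ (mul_le_mul (hE.trans hG) hP (by positivity)
    (Real.Gamma_pos_of_pos (by linarith)).le)
  nlinarith [pow_nonneg h0 3, pow_nonneg h0 4, mul_nonneg h0 (sq_nonneg (u - 0.126)),
    sq_nonneg (u - 0.126), mul_nonneg (pow_nonneg h0 3) (sub_nonneg.mpr h1),
    mul_nonneg (pow_nonneg h0 4) (sub_nonneg.mpr h1)]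

/-- `β` is positive and strictly convex on `(−2, ∞)`, tends to `+∞` as `x → −2⁺` and as
`x → +∞`, attains its global minimum on `(−2, ∞)` at a unique point `x₀`, and
`β(x) ≥ β(x₀) > 0.401` for all `x ∈ (−2, ∞)`. -/
theorem kurepaBeta_properties :
    (∀ x ∈ Set.Ioi (-2 : ℝ), 0 < kurepaBeta x) ∧
    StrictConvexOn ℝ (Set.Ioi (-2 : ℝ)) kurepaBeta ∧
    Tendsto kurepaBeta (nhdsWithin (-2 : ℝ) (Set.Ioi (-2 : ℝ))) atTop ∧
    Tendsto kurepaBeta atTop atTop ∧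
    ∃! x₀ : ℝ, x₀ ∈ Set.Ioi (-2 : ℝ) ∧ IsMinOn kurepaBeta (Set.Ioi (-2 : ℝ)) x₀ ∧
      (∀ x ∈ Set.Ioi (-2 : ℝ), kurepaBeta x₀ ≤ kurepaBeta x) ∧
      (0.401 : ℝ) < kurepaBeta x₀ := by
  obtain ⟨x₀, hx₀, hmin⟩ := exists_kurepaBeta_min
  have hx₀' : x₀ ∈ Set.Ioi (-2 : ℝ) := Set.mem_Ioi.mpr (by linarith [hx₀.1])
  refine ⟨fun x hx => kurepaBeta_pos hx, kurepaBeta_strictConvexOn, tendsto_kurepaBeta_neg_two,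
    tendsto_kurepaBeta_atTop, x₀, ⟨hx₀', hmin, hmin, ?_⟩, ?_⟩
  · rcases le_total 0 x₀ with h | h
    · exact lt_kurepaBeta_of_nonneg h hx₀.2
    · simpa using lt_kurepaBeta_neg (neg_nonneg.mpr h) (neg_le.mp hx₀.1)
  · rintro y ⟨hy, hymin, -⟩
    exact kurepaBeta_strictConvexOn.eq_of_isMinOn hymin hmin hy hx₀'
end

section
/- For every real x > −1, the real part of the alternating Kurepa function satisfies F(x) + F(x−1) = Γ(x+1), where Γ is the real Gamma function. -/
open MeasureTheory

/-- The real part of the alternating Kurepa function: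
`F(x) = ∫₀^∞ e^{−t} (t^{x+1} − cos(πx)·t)/(t+1) dt`, convergent for `x > −2`. -/
noncomputable def reAltKurepa (x : ℝ) : ℝ :=
  ∫ t in Set.Ioi (0 : ℝ), Real.exp (-t) * (t ^ (x + 1) - Real.cos (Real.pi * x) * t) / (t + 1)

theorem integrableOn_exp_neg_mul_rpow_div_add_one {s : ℝ} (hs : -1 < s) :
    IntegrableOn (fun t : ℝ => Real.exp (-t) * t ^ s / (t + 1)) (Set.Ioi 0) := by
  have hG : IntegrableOn (fun t : ℝ => Real.exp (-t) * t ^ s) (Set.Ioi 0) := by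
    simpa using Real.GammaIntegral_convergent (s := s + 1) (by linarith)
  refine Integrable.mono hG (Measurable.aestronglyMeasurable (by fun_prop)) ?_
  filter_upwards [ae_restrict_mem measurableSet_Ioi] with t ht
  have ht' : (0 : ℝ) < t := ht
  rw [norm_div]
  refine div_le_self (norm_nonneg _) ?_
  rw [Real.norm_of_nonneg (by linarith)]
  linarith

theorem integrableOn_reAltKurepa_integrand {x : ℝ} (hx : -2 < x) :
    IntegrableOn (fun t : ℝ =>
      Real.exp (-t) * (t ^ (x + 1) - Real.cos (Real.pi * x) * t) / (t + 1)) (Set.Ioi 0) := by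
  have h₁ := integrableOn_exp_neg_mul_rpow_div_add_one (s := x + 1) (by linarith)
  have h₂ := (integrableOn_exp_neg_mul_rpow_div_add_one (s := 1) (by norm_num)).const_mul
    (Real.cos (Real.pi * x))
  refine (h₁.sub h₂).congr (ae_of_all _ fun t => ?_)
  simp only [Pi.sub_apply, Real.rpow_one]
  ring

/-- For every real `x > −1`, `F(x) + F(x−1) = Γ(x+1)`. -/
theorem reAltKurepa_add_self_sub_one (x : ℝ) (hx : -1 < x) :
    reAltKurepa x + reAltKurepa (x - 1) = Real.Gamma (x + 1) := by
  have hcos : Real.cos (Real.pi * (x - 1)) = -Real.cos (Real.pi * x) := by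
    rw [mul_sub, mul_one, Real.cos_sub_pi]
  rw [Real.Gamma_eq_integral (by linarith), reAltKurepa, reAltKurepa,
    ← integral_add (integrableOn_reAltKurepa_integrand (by linarith))
      (integrableOn_reAltKurepa_integrand (by linarith))]
  refine setIntegral_congr_fun measurableSet_Ioi fun t ht => ?_
  have ht' : (0 : ℝ) < t := ht
  have ht₁ : t + 1 ≠ 0 := by positivity
  simp only [hcos, sub_add_cancel, add_sub_cancel_right, Real.rpow_add_one ht'.ne']
  field_simp
  ring
end

section
/- As x → +∞, F(x)/Γ(x+2) tends to 0 and F(x)/Γ(x+1) tends to 1. -/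
open MeasureTheory Filter

lemma norm_reAltKurepa_integrand_sub_le {x c t : ℝ} (hc : |c| ≤ 1) (ht : 0 < t) :
    ‖Real.exp (-t) * (t ^ (x + 1) - c * t) / (t + 1) - Real.exp (-t) * t ^ x‖ ≤
      Real.exp (-t) * t ^ (x - 1) + Real.exp (-t) := by
  have h1 : t ^ (x + 1) = t ^ (x - 1) * t * t := by
    rw [← Real.rpow_add_one ht.ne', ← Real.rpow_add_one ht.ne', sub_add_cancel]
  have h2 : t ^ x = t ^ (x - 1) * t := by
    rw [← Real.rpow_add_one ht.ne', sub_add_cancel]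
  have hp : 0 ≤ t ^ (x - 1) := Real.rpow_nonneg ht.le _
  have heq : Real.exp (-t) * (t ^ (x + 1) - c * t) / (t + 1) - Real.exp (-t) * t ^ x =
      -(Real.exp (-t) * (t / (t + 1)) * (t ^ (x - 1) + c)) := by
    rw [h1, h2]
    field_simp
    ring
  have hfrac : t / (t + 1) ≤ 1 := (div_le_one (by positivity)).2 (by linarith)
  have habs : |t ^ (x - 1) + c| ≤ t ^ (x - 1) + 1 :=
    (abs_add_le _ _).trans (by rw [abs_of_nonneg hp]; gcongr)
  rw [heq, norm_neg, Real.norm_eq_abs, abs_mul, abs_of_nonneg (by positivity)]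
  calc Real.exp (-t) * (t / (t + 1)) * |t ^ (x - 1) + c|
      ≤ Real.exp (-t) * 1 * (t ^ (x - 1) + 1) := by gcongr
    _ = Real.exp (-t) * t ^ (x - 1) + Real.exp (-t) := by ring

lemma abs_reAltKurepa_sub_Gamma_le {x : ℝ} (hx : 0 < x) :
    |reAltKurepa x - Real.Gamma (x + 1)| ≤ Real.Gamma x + 1 := by
  have hΓ : IntegrableOn (fun t : ℝ => Real.exp (-t) * t ^ x) (Set.Ioi 0) := by
    simpa using Real.GammaIntegral_convergent (s := x + 1) (by linarith)
  have hbound : IntegrableOn (fun t : ℝ => Real.exp (-t) * t ^ (x - 1) + Real.exp (-t))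
      (Set.Ioi 0) :=
    (Real.GammaIntegral_convergent hx).add (integrableOn_exp_neg_Ioi 0)
  have hle : ∀ᵐ t ∂(volume.restrict (Set.Ioi (0 : ℝ))),
      ‖Real.exp (-t) * (t ^ (x + 1) - Real.cos (Real.pi * x) * t) / (t + 1) -
        Real.exp (-t) * t ^ x‖ ≤ Real.exp (-t) * t ^ (x - 1) + Real.exp (-t) :=
    (ae_restrict_mem measurableSet_Ioi).mono fun t ht =>
      norm_reAltKurepa_integrand_sub_le (Real.abs_cos_le_one _) ht
  have hdiff := hbound.mono' (Measurable.aestronglyMeasurable (by fun_prop)) hle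
  have hF : IntegrableOn (fun t : ℝ =>
      Real.exp (-t) * (t ^ (x + 1) - Real.cos (Real.pi * x) * t) / (t + 1)) (Set.Ioi 0) :=
    (hdiff.add hΓ).congr (Eventually.of_forall fun t => by simp)
  have hΓeq : Real.Gamma (x + 1) = ∫ t in Set.Ioi (0 : ℝ), Real.exp (-t) * t ^ x := by
    simpa using Real.Gamma_eq_integral (s := x + 1) (by linarith)
  rw [reAltKurepa, hΓeq, ← integral_sub hF hΓ, ← Real.norm_eq_abs]
  refine (norm_integral_le_of_norm_le hbound hle).trans_eq ?_
  rw [integral_add (Real.GammaIntegral_convergent hx) (integrableOn_exp_neg_Ioi 0),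
    ← Real.Gamma_eq_integral hx, integral_exp_neg_Ioi_zero]

lemma abs_reAltKurepa_div_Gamma_sub_one_le {x : ℝ} (hx : 2 ≤ x) :
    |reAltKurepa x / Real.Gamma (x + 1) - 1| ≤ 2 / x := by
  have hx0 : 0 < x := by linarith
  have hΓ : 1 ≤ Real.Gamma x := by
    simpa using Real.Gamma_strictMonoOn_Ici.monotoneOn Set.self_mem_Ici hx hx
  have hpos : 0 < Real.Gamma (x + 1) := Real.Gamma_pos_of_pos (by linarith)
  rw [div_sub_one hpos.ne', abs_div, abs_of_pos hpos, div_le_div_iff₀ hpos hx0,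
    Real.Gamma_add_one hx0.ne']
  have h := abs_reAltKurepa_sub_Gamma_le hx0
  rw [Real.Gamma_add_one hx0.ne'] at h
  nlinarith

/-- As `x → +∞`, `F(x)/Γ(x+2) → 0` and `F(x)/Γ(x+1) → 1`. -/
theorem reAltKurepa_div_gamma_limits :
    Tendsto (fun x : ℝ => reAltKurepa x / Real.Gamma (x + 2)) atTop (nhds 0) ∧
    Tendsto (fun x : ℝ => reAltKurepa x / Real.Gamma (x + 1)) atTop (nhds 1) := by
  have hone : Tendsto (fun x : ℝ => reAltKurepa x / Real.Gamma (x + 1)) atTop (nhds 1) := by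
    rw [tendsto_iff_norm_sub_tendsto_zero]
    refine squeeze_zero' (Eventually.of_forall fun x => norm_nonneg _) ?_
      (tendsto_const_nhds.div_atTop tendsto_id : Tendsto (fun x : ℝ => 2 / x) atTop (nhds 0))
    filter_upwards [eventually_ge_atTop 2] with x hx
    exact abs_reAltKurepa_div_Gamma_sub_one_le hx
  refine ⟨?_, hone⟩
  refine (hone.div_atTop (tendsto_atTop_add_const_right atTop (1 : ℝ) tendsto_id)).congr' ?_
  filter_upwards [eventually_ge_atTop 0] with x hx
  have hx1 : x + 1 ≠ 0 := by positivity
  rw [show x + 2 = x + 1 + 1 by ring, Real.Gamma_add_one hx1, div_div, id, mul_comm]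
end
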